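/- Saturation of the optimal target measure (analytic form of Theorem 6.7). Let U ⊆ ℝ^d be a bounded open set, f : ℝ^d → ℝ a bounded measurable function with f > 0, and u : U → ℝ a bounded smooth function with u ≥ 0 and Δu(x) < 0 for all x ∈ U. Let μ be a finite Borel measure supported in U, and let ν be a finite Borel measure supported in U, absolutely continuous with respect to Lebesgue measure with density g satisfying 0 ≤ g ≤ f almost everywhere. Let φ ∈ L¹(U) with φ ≤ 0 a.e. on U, and let ψ : U → ℝ be superharmonic with ψ ∈ L¹(U), ψ integrable with respect to both μ and ν, and ψ(x) ≥ φ(x) − u(x) for a.e. x ∈ U. Assume: (i) ∫_U ψ dμ ≥ ∫_U ψ dν (subharmonic domination of μ by ν), and (ii) the zero-duality-gap identity ∫_U u(x) g(x) dx = ∫_U φ(x) f(x) dx − ∫_U ψ dμ. Then g = f·χ_{{φ<0}} Lebesgue-almost everywhere on U; that is, g(x) = f(x) for a.e. x with φ(x) < 0 and g(x) = 0 for a.e. x with φ(x) = 0. -/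

import Mathlib

open MeasureTheory Metric Set

noncomputable def laplacian {d : ℕ} (f : EuclideanSpace ℝ (Fin d) → ℝ)
    (x : EuclideanSpace ℝ (Fin d)) : ℝ :=
  ∑ i : Fin d, iteratedFDeriv ℝ 2 f x
    ![EuclideanSpace.single i (1:ℝ), EuclideanSpace.single i (1:ℝ)]

/-- A function is superharmonic on an open set `U` if it is lower semicontinuous on `U`
and satisfies the super-mean-value property on every closed ball contained in `U`. -/
def Superharmonic {d : ℕ} (U : Set (EuclideanSpace ℝ (Fin d)))
    (ψ : EuclideanSpace ℝ (Fin d) → ℝ) : Prop :=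
  LowerSemicontinuousOn ψ U ∧
  ∀ x ∈ U, ∀ ρ : ℝ, 0 < ρ → closedBall x ρ ⊆ U →
    ⨍ y in closedBall x ρ, ψ y ≤ ψ x

section BallAverages

variable {d : ℕ}

theorem setIntegral_closedBall_comp_isometry
    (e : EuclideanSpace ℝ (Fin d) ≃ₗᵢ[ℝ] EuclideanSpace ℝ (Fin d)) (s : ℝ)
    (F : EuclideanSpace ℝ (Fin d) → ℝ) :
    ∫ h in closedBall 0 s, F (e h) = ∫ h in closedBall 0 s, F h := by
  have := e.measurePreserving.setIntegral_preimage_emb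
    e.toHomeomorph.measurableEmbedding F (closedBall 0 s)
  have h2 : (e : EuclideanSpace ℝ (Fin d) → EuclideanSpace ℝ (Fin d)) ⁻¹' closedBall 0 s
      = closedBall 0 s := by
    simp
  rwa [h2] at this

theorem integral_coord_mul_coord_of_ne {i j : Fin d} (hij : i ≠ j) (s : ℝ) :
    ∫ h : EuclideanSpace ℝ (Fin d) in closedBall 0 s, h i * h j = 0 := by
  have := setIntegral_closedBall_comp_isometry
    (LinearIsometryEquiv.piLpCongrRight 2
      (fun k : Fin d => if k = i then LinearIsometryEquiv.neg ℝ (E := ℝ)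
        else LinearIsometryEquiv.refl ℝ ℝ)) s (fun h => h i * h j)
  simp [LinearIsometryEquiv.piLpCongrRight_apply, hij.symm, integral_neg] at this
  linarith

theorem integral_coord_sq_eq (i j : Fin d) (s : ℝ) :
    ∫ h : EuclideanSpace ℝ (Fin d) in closedBall 0 s, h i * h i =
      ∫ h : EuclideanSpace ℝ (Fin d) in closedBall 0 s, h j * h j := by
  have := setIntegral_closedBall_comp_isometry
    (LinearIsometryEquiv.piLpCongrLeft 2 ℝ ℝ (Equiv.swap i j)) s (fun h => h j * h j)
  simpa [LinearIsometryEquiv.piLpCongrLeft_apply, Equiv.piCongrLeft'_apply] using this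

theorem integral_clm_closedBall_zero (l : EuclideanSpace ℝ (Fin d) →L[ℝ] ℝ) (s : ℝ) :
    ∫ h in closedBall 0 s, l h = 0 := by
  have := setIntegral_closedBall_comp_isometry (d := d) (LinearIsometryEquiv.neg ℝ) s l
  simp [integral_neg] at this
  linarith

theorem integrableOn_closedBall_of_continuous {F : EuclideanSpace ℝ (Fin d) → ℝ}
    (hF : Continuous F) (y : EuclideanSpace ℝ (Fin d)) (s : ℝ) :
    IntegrableOn F (closedBall y s) :=
  hF.continuousOn.integrableOn_compact (isCompact_closedBall y s)

theorem bilin_eq_sum (B : EuclideanSpace ℝ (Fin d) →L[ℝ] EuclideanSpace ℝ (Fin d) →L[ℝ] ℝ)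
    (h : EuclideanSpace ℝ (Fin d)) :
    B h h = ∑ i, ∑ j, h i * h j *
      B (EuclideanSpace.single i 1) (EuclideanSpace.single j 1) := by
  have hh : h = ∑ i, h i • EuclideanSpace.single i (1 : ℝ) := by
    simpa using ((EuclideanSpace.basisFun (Fin d) ℝ).sum_repr h).symm
  conv_lhs => rw [hh]
  simp only [map_sum, map_smul, sum_apply, smul_apply,
    smul_eq_mul, Finset.mul_sum]
  rw [Finset.sum_comm]
  exact Finset.sum_congr rfl fun i _ => Finset.sum_congr rfl fun j _ => by ring

theorem integral_bilin_closedBall_zero (i₀ : Fin d)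
    (B : EuclideanSpace ℝ (Fin d) →L[ℝ] EuclideanSpace ℝ (Fin d) →L[ℝ] ℝ) (s : ℝ) :
    ∫ h in closedBall 0 s, B h h =
      (∫ h : EuclideanSpace ℝ (Fin d) in closedBall 0 s, h i₀ * h i₀) *
        ∑ i, B (EuclideanSpace.single i 1) (EuclideanSpace.single i 1) := by
  have hint : ∀ i j : Fin d, IntegrableOn (fun h : EuclideanSpace ℝ (Fin d) => h i * h j *
      B (EuclideanSpace.single i 1) (EuclideanSpace.single j 1)) (closedBall 0 s) :=
    fun i j => integrableOn_closedBall_of_continuous (by fun_prop) _ _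
  rw [funext (bilin_eq_sum B)]
  rw [integral_finsetSum _ fun i _ => integrable_finsetSum _ fun j _ => hint i j, Finset.mul_sum]
  refine Finset.sum_congr rfl fun i _ => ?_
  rw [integral_finsetSum _ fun j _ => hint i j, Finset.sum_eq_single i]
  · rw [integral_mul_const, integral_coord_sq_eq i i₀]
  · intro j _ hj
    rw [integral_mul_const, integral_coord_mul_coord_of_ne hj.symm, zero_mul]
  · simp

theorem integral_coord_sq_scale (i : Fin d) {s : ℝ} (hs : 0 < s) :
    ∫ h : EuclideanSpace ℝ (Fin d) in closedBall 0 s, h i * h i =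
      s ^ 2 * s ^ d * ∫ h : EuclideanSpace ℝ (Fin d) in closedBall 0 1, h i * h i := by
  have := Measure.setIntegral_comp_smul_of_pos volume
    (fun h : EuclideanSpace ℝ (Fin d) => h i * h i) (closedBall 0 1) hs
  rw [smul_unitClosedBall_of_nonneg hs.le, finrank_euclideanSpace_fin] at this
  have h2 : ∀ h : EuclideanSpace ℝ (Fin d), (s • h) i * (s • h) i = s ^ 2 * (h i * h i) := by
    intro h; simp; ring
  simp_rw [h2, integral_const_mul, smul_eq_mul] at this
  rw [mul_right_comm, this]
  field_simp

theorem integral_coord_sq_pos (i : Fin d) :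
    0 < ∫ h : EuclideanSpace ℝ (Fin d) in closedBall 0 1, h i * h i := by
  have hnn : 0 ≤ᵐ[volume.restrict (closedBall (0 : EuclideanSpace ℝ (Fin d)) 1)]
      fun h : EuclideanSpace ℝ (Fin d) => h i * h i :=
    Filter.Eventually.of_forall fun h => mul_self_nonneg (h i)
  rw [integral_pos_iff_support_of_nonneg_ae hnn
    (integrableOn_closedBall_of_continuous (by fun_prop) _ _)]
  have hopen : IsOpen {h : EuclideanSpace ℝ (Fin d) | h i * h i ≠ 0} :=
    isOpen_ne_fun (by fun_prop) (by fun_prop)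
  refine lt_of_lt_of_le ?_ (Measure.le_restrict_apply _ _)
  refine lt_of_lt_of_le ?_ (measure_mono (inter_subset_inter_right _ ball_subset_closedBall))
  refine (hopen.inter isOpen_ball).measure_pos volume ⟨EuclideanSpace.single i (1 / 2), ?_, ?_⟩
  · simp
  · simp
    norm_num

/-- The solid mean over a ball of a quadratic polynomial exceeds its value at the center by a
fixed multiple of the trace of the quadratic part. -/
theorem exists_average_quadratic (i₀ : Fin d) : ∃ κ : ℝ, 0 < κ ∧
    ∀ (B : EuclideanSpace ℝ (Fin d) →L[ℝ] EuclideanSpace ℝ (Fin d) →L[ℝ] ℝ)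
      (L : EuclideanSpace ℝ (Fin d) →L[ℝ] ℝ) (c : ℝ) (x y : EuclideanSpace ℝ (Fin d)) (s : ℝ),
      0 < s → ⨍ z in closedBall y s, (c + L (z - x) + B (z - x) (z - x)) =
        c + L (y - x) + B (y - x) (y - x) + κ * s ^ 2 *
          ∑ i, B (EuclideanSpace.single i 1) (EuclideanSpace.single i 1) := by
  set V := volume.real (closedBall (0 : EuclideanSpace ℝ (Fin d)) 1) with hV
  have hVpos : 0 < V := 
    ENNReal.toReal_pos (measure_closedBall_pos _ _ one_pos).ne' measure_closedBall_lt_top.ne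
  refine ⟨(∫ h : EuclideanSpace ℝ (Fin d) in closedBall 0 1, h i₀ * h i₀) / V,
    div_pos (integral_coord_sq_pos i₀) hVpos, fun B L c x y s hs => ?_⟩
  have hVs : volume.real (closedBall y s) = s ^ d * V := by
    rw [Measure.addHaar_real_closedBall' _ _ hs.le, finrank_euclideanSpace_fin]
  have htrans : ∫ z in closedBall y s, (c + L (z - x) + B (z - x) (z - x)) =
      ∫ h in closedBall 0 s, (c + L (h + y - x) + B (h + y - x) (h + y - x)) := by
    have := (measurePreserving_add_right volume y).setIntegral_preimage_emb
      (measurableEmbedding_addRight y)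
      (fun z => c + L (z - x) + B (z - x) (z - x)) (closedBall y s)
    rw [← this]
    congr 2
    ext h
    simp
  have hexp : ∀ h, c + L (h + y - x) + B (h + y - x) (h + y - x) =
      (c + L (y - x) + B (y - x) (y - x)) + (L + B (y - x) + B.flip (y - x)) h + B h h := by
    intro h
    rw [add_sub_assoc]
    simp only [map_add, add_apply, ContinuousLinearMap.flip_apply]
    ring
  rw [setAverage_eq, htrans, hVs]
  simp_rw [hexp]
  rw [integral_add, integral_add, integral_clm_closedBall_zero, setIntegral_const,
    integral_bilin_closedBall_zero i₀, integral_coord_sq_scale i₀ hs,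
    Measure.addHaar_real_closedBall' _ _ hs.le, finrank_euclideanSpace_fin, ← hV]
  · simp only [smul_eq_mul]
    field_simp
    ring
  all_goals exact integrableOn_closedBall_of_continuous (by fun_prop) _ _

end BallAverages

/-- Second order Taylor expansion in Peano form. -/
theorem isLittleO_sub_quadratic {E : Type*} [NormedAddCommGroup E] [NormedSpace ℝ E]
    {u : E → ℝ} {x : E} (hu : ContDiffAt ℝ 2 u x) :
    (fun z => u z - (u x + fderiv ℝ u x (z - x) +
      ((1 / 2 : ℝ) • fderiv ℝ (fderiv ℝ u) x) (z - x) (z - x))) =o[nhds x]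
        fun z => ‖z - x‖ ^ 2 := by
  set B := fderiv ℝ (fderiv ℝ u) x with hB
  have hsymm : ∀ v w, B v w = B w v := fun v w =>
    hu.isSymmSndFDerivAt (by simp) v w
  have hdiff : ∀ᶠ z in nhds x, DifferentiableAt ℝ u z := by
    filter_upwards [hu.eventually (by simp)] with z hz using hz.differentiableAt (by simp)
  obtain ⟨ε, hε, hball⟩ := Metric.eventually_nhds_iff_ball.1 hdiff
  have hd2 : HasFDerivAt (fderiv ℝ u) B x :=
    ((hu.fderiv_right (m := 1) (by norm_num)).differentiableAt (by simp)).hasFDerivAt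
  have hder : ∀ z ∈ ball x ε, HasFDerivWithinAt
      (fun z => u z - (u x + fderiv ℝ u x (z - x) + ((1 / 2 : ℝ) • B) (z - x) (z - x)))
      (fderiv ℝ u z - fderiv ℝ u x - B (z - x)) (ball x ε) z := by
    intro z hz
    have h1 : HasFDerivAt (fun z : E => z - x) (ContinuousLinearMap.id ℝ E) z :=
      (hasFDerivAt_id z).sub_const x
    have h2 := (((1 / 2 : ℝ) • B).hasFDerivAt.comp z h1).clm_apply h1
    have h3 := (fderiv ℝ u x).hasFDerivAt.comp z h1
    refine ((hball z hz).hasFDerivAt.sub ((h3.const_add (u x)).add h2)).hasFDerivWithinAt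
      |>.congr_fderiv ?_
    ext v
    have hv := hsymm v (z - x)
    simp only [map_sub, sub_apply] at hv
    simp
    linarith
  have hlit : (fun z => fderiv ℝ u z - fderiv ℝ u x - B (z - x)) =o[nhdsWithin x (ball x ε)]
      fun z => ‖z - x‖ ^ 1 := by
    simp only [pow_one]
    exact (hd2.isLittleO.norm_right).mono nhdsWithin_le_nhds
  have := (convex_ball x ε).isLittleO_pow_succ (mem_ball_self hε) hder hlit
  rw [nhdsWithin_eq_nhds.2 (ball_mem_nhds x hε)] at this
  simpa using this

theorem not_quadratic_growth_of_decay {M : ℝ → ℝ} {τ R : ℝ} (hτ : 0 < τ) (hR : 0 < R)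
    (hlow : ∀ r, 0 < r → r ≤ R → τ * r ^ 2 ≤ M r)
    (hdecay : ∀ r, 0 < r → 2 * r ≤ R → M r ≤ M (2 * r) / 8 + τ / 4 * r ^ 2) : False := by
  have hr : ∀ k : ℕ, 0 < R / 2 ^ k ∧ R / 2 ^ k ≤ R := fun k =>
    ⟨by positivity, div_le_self hR.le (one_le_pow₀ one_le_two)⟩
  have hstep : ∀ k : ℕ, M (R / 2 ^ k) / (R / 2 ^ k) ^ 2 ≤ M R / R ^ 2 - k * (τ / 4) := by
    intro k
    induction k with
    | zero => simp
    | succ k ih =>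
      have h2 : 2 * (R / 2 ^ (k + 1)) = R / 2 ^ k := by rw [pow_succ]; field_simp
      have hpos := (hr (k + 1)).1
      have hd := hdecay _ hpos (h2 ▸ (hr k).2)
      have hl := hlow _ (hr k).1 (hr k).2
      rw [← h2] at ih hl
      rw [div_le_iff₀ (by positivity)] at ih ⊢
      push_cast
      nlinarith
  obtain ⟨k, hk⟩ := exists_nat_gt (M R / R ^ 2 / (τ / 4))
  rw [div_lt_iff₀ (by positivity)] at hk
  have hl := hlow _ (hr k).1 (hr k).2
  rw [← le_div_iff₀ (pow_pos (hr k).1 2)] at hl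
  linarith [hstep k]

section Density

variable {d : ℕ}

theorem volume_real_closedBall_two_mul (x y : EuclideanSpace ℝ (Fin d)) {r : ℝ} (hr : 0 < r) :
    volume.real (closedBall x (2 * r)) = 2 ^ d * volume.real (closedBall y r) := by
  rw [Measure.addHaar_real_closedBall' _ _ (by positivity),
    Measure.addHaar_real_closedBall' _ _ hr.le, finrank_euclideanSpace_fin, mul_pow, mul_assoc]

theorem volume_real_closedBall_pos (x : EuclideanSpace ℝ (Fin d)) {r : ℝ} (hr : 0 < r) :
    0 < volume.real (closedBall x r) :=
  ENNReal.toReal_pos (measure_closedBall_pos _ _ hr).ne' measure_closedBall_lt_top.ne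

/-- A nonnegative function with the sub-mean-value property is controlled on a ball by its size
on a set of nearly full density in the doubled ball. -/
theorem subharmonic_le_of_density {v : EuclideanSpace ℝ (Fin d) → ℝ}
    {x y : EuclideanSpace ℝ (Fin d)} {r δ a b : ℝ} {T : Set (EuclideanSpace ℝ (Fin d))}
    (hr : 0 < r) (hv0 : ∀ z, 0 ≤ v z) (hvint : IntegrableOn v (closedBall x (2 * r)))
    (hb : 0 ≤ b) (hvb : ∀ z ∈ closedBall x (2 * r), v z ≤ b) (hT : MeasurableSet T)
    (ha : 0 ≤ a) (hva : ∀ z ∈ closedBall x (2 * r), z ∈ T → v z ≤ a)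
    (hδ : volume.real (closedBall x (2 * r) \ T) ≤ δ * volume.real (closedBall x (2 * r)))
    (hy : y ∈ closedBall x r) (hmean : v y ≤ ⨍ z in closedBall y r, v z) :
    v y ≤ 2 ^ d * (a + δ * b) := by
  have hsub : closedBall y r ⊆ closedBall x (2 * r) := by
    refine closedBall_subset_closedBall' ?_
    rw [mem_closedBall] at hy
    linarith
  have h1 : ∫ z in closedBall y r, v z ≤ ∫ z in closedBall x (2 * r), v z :=
    setIntegral_mono_set hvint (Filter.Eventually.of_forall hv0) hsub.eventuallyLE
  have hfin : volume (closedBall x (2 * r)) ≠ ⊤ := measure_closedBall_lt_top.ne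
  have h2 : ∫ z in closedBall x (2 * r) ∩ T, v z ≤ a * volume.real (closedBall x (2 * r)) := by
    calc _ ≤ ∫ z in closedBall x (2 * r) ∩ T, a :=
          setIntegral_mono_on (hvint.mono_set inter_subset_left)
            (integrableOn_const (measure_ne_top_of_subset inter_subset_left hfin))
            (measurableSet_closedBall.inter hT) fun z hz => hva z hz.1 hz.2
      _ = volume.real (closedBall x (2 * r) ∩ T) * a := by simp
      _ ≤ _ := by
        rw [mul_comm]
        exact mul_le_mul_of_nonneg_left (measureReal_mono inter_subset_left hfin) ha
  have h3 : ∫ z in closedBall x (2 * r) \ T, v z ≤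
      δ * volume.real (closedBall x (2 * r)) * b := by
    calc _ ≤ ∫ z in closedBall x (2 * r) \ T, b :=
          setIntegral_mono_on (hvint.mono_set sdiff_subset)
            (integrableOn_const (measure_ne_top_of_subset sdiff_subset hfin))
            (measurableSet_closedBall.diff hT) fun z hz => hvb z hz.1
      _ = volume.real (closedBall x (2 * r) \ T) * b := by simp
      _ ≤ _ := mul_le_mul_of_nonneg_right hδ hb
  have h4 := integral_inter_add_sdiff hT hvint
  rw [setAverage_eq, smul_eq_mul] at hmean
  have hV := volume_real_closedBall_pos y hr
  rw [volume_real_closedBall_two_mul x y hr] at h2 h3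
  refine hmean.trans ?_
  rw [inv_mul_le_iff₀ hV]
  linarith

end Density

section NullLevelSet

variable {d : ℕ} {U : Set (EuclideanSpace ℝ (Fin d))} {ψ u : EuclideanSpace ℝ (Fin d) → ℝ}

theorem eventually_measureReal_closedBall_sdiff_le {T : Set (EuclideanSpace ℝ (Fin d))}
    {x : EuclideanSpace ℝ (Fin d)} (hT : MeasurableSet T)
    (hdens : Filter.Tendsto (fun r => volume (T ∩ closedBall x r) / volume (closedBall x r))
      (nhdsWithin 0 (Ioi 0)) (nhds 1)) {δ : ℝ} (hδ : 0 < δ) :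
    ∀ᶠ r in nhdsWithin (0 : ℝ) (Ioi 0),
      volume.real (closedBall x r \ T) ≤ δ * volume.real (closedBall x r) := by
  have hreal := (ENNReal.tendsto_toReal ENNReal.one_ne_top).comp hdens
  filter_upwards [hreal.eventually (lt_mem_nhds (show 1 - δ < (1 : ENNReal).toReal by simpa)),
    self_mem_nhdsWithin] with r hr hr0
  have hV := volume_real_closedBall_pos x hr0
  have hsum := measureReal_inter_add_sdiff (μ := volume) (s := closedBall x r) hT
    measure_closedBall_lt_top.ne
  rw [Function.comp_apply, ENNReal.toReal_div, inter_comm] at hr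
  change _ < volume.real _ / volume.real _ at hr
  rw [lt_div_iff₀ hV] at hr
  linarith

theorem laplacian_eq_sum (u : EuclideanSpace ℝ (Fin d) → ℝ) (x : EuclideanSpace ℝ (Fin d)) :
    laplacian u x = ∑ i, fderiv ℝ (fderiv ℝ u) x (EuclideanSpace.single i 1)
      (EuclideanSpace.single i 1) := by
  simp [laplacian, iteratedFDeriv_two_apply]

/-- The set where a superharmonic function agrees with `-u` has no density point at which `u` is
strictly superharmonic. -/
theorem Superharmonic.not_density_point (hU : IsOpen U) (hψ : Superharmonic U ψ)
    (hψint : IntegrableOn ψ U) {x : EuclideanSpace ℝ (Fin d)} (hx : x ∈ U)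
    (hu : ContDiffAt ℝ 2 u x) (hlap : laplacian u x < 0)
    {T : Set (EuclideanSpace ℝ (Fin d))} (hT : MeasurableSet T) (hxT : x ∈ T)
    (hψT : ∀ z ∈ T, ψ z + u z = 0)
    (hdens : Filter.Tendsto (fun r => volume (T ∩ closedBall x r) / volume (closedBall x r))
      (nhdsWithin 0 (Ioi 0)) (nhds 1)) : False := by
  rw [laplacian_eq_sum] at hlap
  obtain ⟨i₀⟩ : Nonempty (Fin d) := by
    by_contra hempty
    rw [not_nonempty_iff] at hempty
    simp at hlap
  obtain ⟨κ, hκ, hquad⟩ := exists_average_quadratic i₀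
  set B := (1 / 2 : ℝ) • fderiv ℝ (fderiv ℝ u) x with hB
  set L := fderiv ℝ u x
  have htaylor := isLittleO_sub_quadratic hu
  set q : EuclideanSpace ℝ (Fin d) → ℝ := fun z => u x + L (z - x) + B (z - x) (z - x) with hq
  have hqcont : Continuous q := by fun_prop
  set S := ∑ i, B (EuclideanSpace.single i 1) (EuclideanSpace.single i 1) with hS
  have hSneg : S < 0 := by
    simp only [hS, hB, smul_apply, smul_eq_mul, ← Finset.mul_sum]
    linarith
  obtain ⟨τ, hτdef⟩ : ∃ τ, τ = -(κ * S) := ⟨_, rfl⟩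
  have hτ : 0 < τ := by
    rw [hτdef, neg_pos]
    exact mul_neg_of_pos_of_neg hκ hSneg
  set v : EuclideanSpace ℝ (Fin d) → ℝ := fun z => max (-(ψ z + q z)) 0 with hv
  have hv0 : ∀ z, 0 ≤ v z := fun z => le_max_right _ _
  have hψball : ∀ y s, closedBall y s ⊆ U → IntegrableOn (fun z => ψ z + q z) (closedBall y s) :=
    fun y s hs => (hψint.mono_set hs).add (integrableOn_closedBall_of_continuous hqcont y s)
  have hvball : ∀ y s, closedBall y s ⊆ U → IntegrableOn v (closedBall y s) :=
    fun y s hs => (hψball y s hs).neg.pos_part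
  have hmean' : ∀ y ∈ U, ∀ s, 0 < s → closedBall y s ⊆ U →
      -(ψ y + q y) + τ * s ^ 2 ≤ ⨍ z in closedBall y s, v z := by
    intro y hy s hs hsU
    have hsuper := hψ.2 y hy s hs hsU
    have hqavg : ⨍ z in closedBall y s, q z = q y + κ * s ^ 2 * S := hquad B L (u x) x y s hs
    have hle : ⨍ z in closedBall y s, -(ψ z + q z) ≤ ⨍ z in closedBall y s, v z := by
      simp only [setAverage_eq, smul_eq_mul]
      exact mul_le_mul_of_nonneg_left
        (setIntegral_mono (hψball y s hsU).neg (hvball y s hsU) fun z => le_max_left _ _)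
        (by positivity)
    have heq : ⨍ z in closedBall y s, -(ψ z + q z) =
        -(⨍ z in closedBall y s, ψ z) - ⨍ z in closedBall y s, q z := by
      simp only [setAverage_eq, smul_eq_mul]
      rw [integral_neg, integral_add (hψint.mono_set hsU)
        (integrableOn_closedBall_of_continuous hqcont y s)]
      ring
    rw [hτdef]
    linarith
  have hmean : ∀ y ∈ U, ∀ s, 0 < s → closedBall y s ⊆ U → v y ≤ ⨍ z in closedBall y s, v z := by
    intro y hy s hs hsU
    refine max_le ?_ ?_
    · have := hmean' y hy s hs hsU
      have : 0 < τ * s ^ 2 := by positivity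
      linarith
    · rw [setAverage_eq]
      exact smul_nonneg (by positivity) (integral_nonneg hv0)
  obtain ⟨δ, hδdef⟩ : ∃ δ : ℝ, δ = 1 / (8 * 2 ^ d) := ⟨_, rfl⟩
  obtain ⟨η, hηdef⟩ : ∃ η : ℝ, η = τ / (16 * 2 ^ d) := ⟨_, rfl⟩
  have hδ : 0 < δ := by rw [hδdef]; positivity
  have hη : 0 < η := by rw [hηdef]; positivity
  obtain ⟨R₁, hR₁, hR₁U⟩ := Metric.nhds_basis_closedBall.mem_iff.1
    (Filter.inter_mem (hU.mem_nhds hx) (htaylor.bound hη))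
  obtain ⟨R₂, hR₂, hR₂d⟩ := mem_nhdsGT_iff_exists_Ioc_subset.1
    (eventually_measureReal_closedBall_sdiff_le hT hdens hδ)
  rw [mem_Ioi] at hR₂
  obtain ⟨R, hRdef⟩ : ∃ R, R = min R₁ R₂ := ⟨_, rfl⟩
  have hR : 0 < R := hRdef ▸ lt_min hR₁ hR₂
  have hRU : closedBall x R ⊆ U := fun z hz =>
    (hR₁U (closedBall_subset_closedBall (hRdef ▸ min_le_left _ _) hz)).1
  have hvT : ∀ r, r ≤ R → ∀ z ∈ closedBall x r, z ∈ T → v z ≤ η * r ^ 2 := by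
    intro r hr z hz hzT
    have hb : ‖u z - q z‖ ≤ η * ‖‖z - x‖ ^ 2‖ := (hR₁U (closedBall_subset_closedBall
      (hr.trans (hRdef ▸ min_le_left _ _)) hz)).2
    rw [Real.norm_eq_abs, norm_pow, norm_norm] at hb
    have hz' : ‖z - x‖ ≤ r := by rwa [mem_closedBall, dist_eq_norm] at hz
    have hb2 : η * ‖z - x‖ ^ 2 ≤ η * r ^ 2 := by gcongr
    refine max_le ?_ (by positivity)
    have := le_abs_self (u z - q z)
    linarith [hψT z hzT]
  have hbdd : BddAbove (v '' closedBall x R) := by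
    obtain ⟨m, hm⟩ := (hψ.1.mono hRU).bddBelow_of_isCompact (isCompact_closedBall x R)
    obtain ⟨m', hm'⟩ := ((isCompact_closedBall x R).image hqcont).bddBelow
    refine ⟨max (-(m + m')) 0, ?_⟩
    rintro _ ⟨z, hz, rfl⟩
    exact max_le_max_right 0
      (neg_le_neg (add_le_add (hm (mem_image_of_mem _ hz)) (hm' (mem_image_of_mem _ hz))))
  have hle : ∀ r, r ≤ R → ∀ z ∈ closedBall x r, v z ≤ sSup (v '' closedBall x r) :=
    fun r hr z hz => le_csSup (hbdd.mono (image_mono (closedBall_subset_closedBall hr)))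
      (mem_image_of_mem v hz)
  refine not_quadratic_growth_of_decay (M := fun r => sSup (v '' closedBall x r)) hτ hR ?_ ?_
  · intro r hr hrR
    have hsub := (closedBall_subset_closedBall hrR).trans hRU
    have h1 := hmean' x hx r hr hsub
    have hqx : q x = u x := by simp [hq]
    rw [hqx, hψT x hxT, neg_zero, zero_add] at h1
    refine h1.trans ?_
    have hV := volume_real_closedBall_pos x hr
    rw [setAverage_eq, smul_eq_mul, inv_mul_le_iff₀ hV]
    calc _ ≤ ∫ z in closedBall x r, sSup (v '' closedBall x r) :=
          setIntegral_mono_on (hvball x r hsub) (integrableOn_const measure_closedBall_lt_top.ne)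
            measurableSet_closedBall (hle r hrR)
      _ = _ := by simp
  · intro r hr hrR
    refine csSup_le ((nonempty_closedBall.2 hr.le).image v) ?_
    rintro _ ⟨y, hy, rfl⟩
    have hsub : closedBall y r ⊆ U := by
      refine (closedBall_subset_closedBall' ?_).trans hRU
      rw [mem_closedBall] at hy
      linarith
    have h := subharmonic_le_of_density (T := T) (δ := δ) hr hv0
      (hvball x (2 * r) ((closedBall_subset_closedBall hrR).trans hRU))
      (Real.sSup_nonneg (by rintro _ ⟨z, -, rfl⟩; exact hv0 z)) (hle _ hrR) hT
      (by positivity) (hvT _ hrR) (hR₂d ⟨by positivity, hrR.trans (hRdef ▸ min_le_right _ _)⟩)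
      hy (hmean y (hsub (mem_closedBall_self hr.le)) r hr hsub)
    refine h.trans (le_of_eq ?_)
    rw [hδdef, hηdef]
    field_simp
    ring

/-- If `ψ` is superharmonic and `u` is strictly superharmonic, then `ψ + u` vanishes only on a
Lebesgue null set. -/
theorem Superharmonic.ae_add_ne_zero (hU : IsOpen U) (hψ : Superharmonic U ψ)
    (hψint : IntegrableOn ψ U) (hu : ContDiffOn ℝ 2 u U) (hlap : ∀ x ∈ U, laplacian u x < 0) :
    ∀ᵐ x ∂(volume : Measure (EuclideanSpace ℝ (Fin d))), x ∈ U → ψ x + u x ≠ 0 := by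
  have hmeas : AEMeasurable (fun x => ψ x + u x) (volume.restrict U) :=
    hψint.aestronglyMeasurable.aemeasurable.add (hu.continuousOn.aemeasurable hU.measurableSet)
  have hnull : NullMeasurableSet ({x | ψ x + u x = 0} ∩ U) volume :=
    (nullMeasurableSet_restrict hU.measurableSet.nullMeasurableSet).1
      (hmeas.nullMeasurable (measurableSet_singleton (0 : ℝ)))
  obtain ⟨T, hTsub, hT, hTae⟩ := hnull.exists_measurable_subset_ae_eq
  have hT0 : volume T = 0 := by
    have h := Besicovitch.ae_tendsto_measure_inter_div
      (volume : Measure (EuclideanSpace ℝ (Fin d))) T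
    rw [ae_restrict_iff' hT] at h
    refine measure_mono_null (fun x hx => ?_) (ae_iff.1 h)
    simp only [mem_ofPred_eq, not_forall]
    exact ⟨hx, fun hdens => hψ.not_density_point hU hψint (hTsub hx).2
      (hu.contDiffAt (hU.mem_nhds (hTsub hx).2)) (hlap x (hTsub hx).2) hT hx
      (fun z hz => (hTsub hz).1) hdens⟩
  rw [measure_congr hTae] at hT0
  filter_upwards [compl_mem_ae_iff.2 hT0] with x hx hxU h0
  exact hx ⟨h0, hxU⟩

end NullLevelSet

/-- **Saturation of the optimal target measure** (analytic form of Theorem 6.7).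
With `U ⊆ ℝ^d` bounded open, `f` bounded measurable positive, `u` bounded smooth nonnegative
with `Δu < 0` on `U`, `μ` a finite Borel measure supported in `U`, and `ν = g·dx` supported in
`U` with density `0 ≤ g ≤ f` a.e.: if `(φ, ψ)` is an admissible dual pair (`φ ∈ L¹(U)`,
`φ ≤ 0` a.e. on `U`, `ψ` superharmonic, `ψ ∈ L¹(U)`, integrable w.r.t. `μ` and `ν`, and
`ψ ≥ φ − u` a.e. on `U`) satisfying (i) `∫ ψ dμ ≥ ∫ ψ dν` and (ii) the zero-duality-gap
identity `∫_U u g dx = ∫_U φ f dx − ∫ ψ dμ`, then `g = f·χ_{{φ<0}}` a.e. on `U`; i.e.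
`g(x) = f(x)` for a.e. `x` with `φ(x) < 0` and `g(x) = 0` for a.e. `x` with `φ(x) = 0`. -/
theorem saturation {d : ℕ}
    (U : Set (EuclideanSpace ℝ (Fin d))) (hUopen : IsOpen U) (hUbdd : Bornology.IsBounded U)
    -- the upper-bound density f : bounded, measurable, positive
    (f : EuclideanSpace ℝ (Fin d) → ℝ) (hfmeas : Measurable f)
    (hfbdd : ∃ M : ℝ, ∀ x, |f x| ≤ M) (hfpos : ∀ x, 0 < f x)
    -- the cost u : bounded, smooth, nonnegative, strictly superharmonic on U
    (u : EuclideanSpace ℝ (Fin d) → ℝ) (husmooth : ContDiffOn ℝ (⊤ : ℕ∞) u U)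
    (hubdd : ∃ M : ℝ, ∀ x ∈ U, |u x| ≤ M) (hunonneg : ∀ x ∈ U, 0 ≤ u x)
    (hulap : ∀ x ∈ U, laplacian u x < 0)
    -- μ : finite Borel measure supported in U
    (μ : Measure (EuclideanSpace ℝ (Fin d))) [IsFiniteMeasure μ] (hμsupp : μ Uᶜ = 0)
    -- ν = g·dx : finite Borel measure supported in U, with density 0 ≤ g ≤ f a.e.
    (g : EuclideanSpace ℝ (Fin d) → ℝ) (hgmeas : Measurable g) (hgint : Integrable g)
    (hg0 : ∀ᵐ x ∂(volume : Measure (EuclideanSpace ℝ (Fin d))), 0 ≤ g x)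
    (hgf : ∀ᵐ x ∂(volume : Measure (EuclideanSpace ℝ (Fin d))), g x ≤ f x)
    (hgsupp : ∀ᵐ x ∂(volume : Measure (EuclideanSpace ℝ (Fin d))), x ∉ U → g x = 0)
    -- the dual pair (φ, ψ)
    (φ ψ : EuclideanSpace ℝ (Fin d) → ℝ)
    (hφint : IntegrableOn φ U)
    (hφ0 : ∀ᵐ x ∂(volume : Measure (EuclideanSpace ℝ (Fin d))), x ∈ U → φ x ≤ 0)
    (hψsh : Superharmonic U ψ) (hψL1 : IntegrableOn ψ U)
    (hψμ : Integrable ψ μ) (hψν : Integrable (fun x => ψ x * g x) volume)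
    (hψφ : ∀ᵐ x ∂(volume : Measure (EuclideanSpace ℝ (Fin d))), x ∈ U → φ x - u x ≤ ψ x)
    -- (i) subharmonic domination of μ by ν for ψ
    (hdom : ∫ x, ψ x * g x ≤ ∫ x, ψ x ∂μ)
    -- (ii) zero duality gap
    (hgap : ∫ x in U, u x * g x = (∫ x in U, φ x * f x) - ∫ x, ψ x ∂μ) :
    ∀ᵐ x ∂(volume : Measure (EuclideanSpace ℝ (Fin d))),
      x ∈ U → ((φ x < 0 → g x = f x) ∧ (φ x = 0 → g x = 0)) := by
  obtain ⟨M, hM⟩ := hfbdd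
  have hUm := hUopen.measurableSet
  have hug : IntegrableOn (fun x => u x * g x) U := by
    obtain ⟨K, hK⟩ := hubdd
    refine hgint.integrableOn.bdd_mul
      (husmooth.continuousOn.aestronglyMeasurable hUm) (c := K) ?_
    rw [ae_restrict_iff' hUm]
    exact Filter.Eventually.of_forall hK
  have hφf : IntegrableOn (fun x => φ x * f x) U :=
    hφint.mul_bdd (c := M) hfmeas.aestronglyMeasurable (Filter.Eventually.of_forall hM)
  have hψg : ∫ x in U, ψ x * g x = ∫ x, ψ x * g x := by
    refine setIntegral_eq_integral_of_ae_compl_eq_zero ?_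
    filter_upwards [hgsupp] with x hx hxU
    rw [hx hxU, mul_zero]
  have hsum : IntegrableOn (fun x => ψ x * g x + u x * g x) U := hψν.integrableOn.add hug
  have hPint : IntegrableOn (fun x => ψ x * g x + u x * g x - φ x * f x) U :=
    hsum.sub hφf
  have hPnn : 0 ≤ᵐ[volume.restrict U] fun x => ψ x * g x + u x * g x - φ x * f x := by
    rw [Filter.EventuallyLE, ae_restrict_iff' hUm]
    filter_upwards [hg0, hgf, hφ0, hψφ] with x h0 hf hφ hψ hxU
    have h1 := mul_nonneg (sub_nonneg.2 (hψ hxU)) h0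
    have h2 := mul_nonneg (neg_nonneg.2 (hφ hxU)) (sub_nonneg.2 hf)
    simp only [Pi.zero_apply]
    linarith
  have hPzero : ∫ x in U, (ψ x * g x + u x * g x - φ x * f x) = 0 := by
    refine le_antisymm ?_ (integral_nonneg_of_ae hPnn)
    rw [integral_sub hsum hφf, integral_add hψν.integrableOn hug, hψg]
    linarith
  rw [setIntegral_eq_zero_iff_of_nonneg_ae hPnn hPint, Filter.EventuallyEq,
    ae_restrict_iff' hUm] at hPzero
  have hne := hψsh.ae_add_ne_zero hUopen hψL1 (husmooth.of_le (by norm_cast)) hulap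
  filter_upwards [hg0, hgf, hφ0, hψφ, hPzero, hne] with x h0 hf hφ hψ hP hne hxU
  have h1 := mul_nonneg (sub_nonneg.2 (hψ hxU)) h0
  have h2 := mul_nonneg (neg_nonneg.2 (hφ hxU)) (sub_nonneg.2 hf)
  have hP := hP hxU
  simp only [Pi.zero_apply] at hP
  refine ⟨fun hneg => ?_, fun hzero => ?_⟩
  · have h3 : -φ x * (f x - g x) = 0 := by linarith
    rcases mul_eq_zero.1 h3 with h | h <;> linarith
  · have h3 : (ψ x + u x) * g x = 0 := by
      rw [hzero] at hP
      linarith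
    exact (mul_eq_zero.1 h3).resolve_left (hne hxU)
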